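/- arXiv:math/9808135 — 4 statements merged into one kernel-verified Lean document; each statement's English description precedes it below -/
import Mathlib

section
/- Let 𝔤 be a finite-dimensional real vector space with dual 𝔤*, let N ≥ 2, and let α be a map assigning to each ordered pair (i,j) with 1 ≤ i,j ≤ N, i ≠ j, a nonzero covector α_{i,j} ∈ 𝔤* such that: (a) α_{j,i} = −α_{i,j} for all i ≠ j; (b) for each i, the covectors α_{i,j}, j ≠ i, are pairwise linearly independent; (c) for all pairwise distinct i, j, k, the difference α_{i,k} − α_{j,k} is a real scalar multiple of α_{i,j}. Then there exist α_1, …, α_N ∈ 𝔤* such that α_{i,j} = α_i − α_j for all i ≠ j. -/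
/-- If `u, v` are linearly independent, `v - w` is a multiple of `u` and `u + w` is a multiple
of `v`, then `v = u + w`. -/
theorem LinearIndependent.eq_add_of_sub_eq_smul_of_add_eq_smul {R V : Type*} [Ring R]
    [AddCommGroup V] [Module R V] {u v w : V} (h : LinearIndependent R ![u, v])
    {c d : R} (hc : v - w = c • u) (hd : u + w = d • v) : v = u + w := by
  have h₀ : (1 - c) • u + (1 - d) • v = 0 := by
    rw [sub_smul, sub_smul, ← hc, ← hd, one_smul, one_smul]
    abel
  have hd₁ : d = 1 := (sub_eq_zero.mp (LinearIndependent.pair_iff.mp h _ _ h₀).2).symm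
  rw [hd, hd₁, one_smul]

/-- **Classification of axial functions on the complete graph on `N` vertices.**
Let `𝔤` be a finite-dimensional real vector space with dual `𝔤*`, let `N ≥ 2`, and let
`a` assign to each ordered pair `(i,j)`, `i ≠ j`, a nonzero covector `a i j ∈ 𝔤*` such that:
(a) `a j i = - a i j`; (b) for each `i`, the covectors `a i j`, `j ≠ i`, are pairwise linearly
independent; (c) for pairwise distinct `i, j, k`, `a i k - a j k` is a scalar multiple of
`a i j`.  Then there exist `b 1, …, b N ∈ 𝔤*` with `a i j = b i - b j` for all `i ≠ j`. -/
theorem axialFunction_completeGraph_classification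
    {W : Type*} [AddCommGroup W] [Module ℝ W] [FiniteDimensional ℝ W]
    (N : ℕ) (hN : 2 ≤ N) (a : Fin N → Fin N → Module.Dual ℝ W)
    (hnz : ∀ i j, i ≠ j → a i j ≠ 0)
    (hskew : ∀ i j, i ≠ j → a j i = - a i j)
    (hindep : ∀ i j k, i ≠ j → i ≠ k → j ≠ k → LinearIndependent ℝ ![a i j, a i k])
    (hcompat : ∀ i j k, i ≠ j → i ≠ k → j ≠ k → ∃ c : ℝ, a i k - a j k = c • a i j) :
    ∃ b : Fin N → Module.Dual ℝ W, ∀ i j, i ≠ j → a i j = b i - b j := by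
  have cocycle : ∀ i j k, i ≠ j → i ≠ k → j ≠ k → a i k = a i j + a j k := by
    intro i j k hij hik hjk
    obtain ⟨c, hc⟩ := hcompat i j k hij hik hjk
    obtain ⟨d, hd⟩ := hcompat i k j hik hij hjk.symm
    rw [hskew j k hjk, sub_neg_eq_add] at hd
    exact (hindep i j k hij hik hjk).eq_add_of_sub_eq_smul_of_add_eq_smul hc hd
  let z : Fin N := ⟨0, by omega⟩
  refine ⟨fun i => if i = z then 0 else a i z, fun i j hij => ?_⟩
  by_cases hi : i = z
  · have hj : j ≠ z := fun h => hij (hi.trans h.symm)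
    simp [hi, hj, hskew j z hj]
  by_cases hj : j = z
  · simp [hj, hi]
  simp [hi, hj, cocycle i j z hij hi hj]
end

section
/- Let K be a field, let z_1, …, z_d ∈ K be pairwise distinct, and let f ∈ K[t]. Then (t − z_1)⋯(t − z_d) divides f in K[t] if and only if Σ_{j=1}^d z_j^k · f(z_j) / ∏_{r ≠ j} (z_j − z_r) = 0 for every integer k ≥ 0. -/
open Polynomial

/-- **Divisibility via vanishing of residues (Lemma 2.2).** Let `K` be a field, let
`z 1, …, z d ∈ K` be pairwise distinct and let `f ∈ K[t]`.  Then `(t - z 1)⋯(t - z d)` divides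
`f` if and only if `Σ_j z_j^k · f(z_j) / ∏_{r ≠ j} (z_j - z_r) = 0` for every integer
`k ≥ 0`. -/
theorem prod_dvd_iff_residues_vanish
    {K : Type*} [Field K] (d : ℕ) (z : Fin d → K) (hz : Function.Injective z)
    (f : Polynomial K) :
    (∏ j : Fin d, (Polynomial.X - Polynomial.C (z j))) ∣ f ↔
      ∀ k : ℕ, ∑ j : Fin d,
          z j ^ k * f.eval (z j) / ∏ r ∈ Finset.univ.erase j, (z j - z r) = 0 := by
  have hne (j : Fin d) : ∏ r ∈ Finset.univ.erase j, (z j - z r) ≠ 0 :=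
    Finset.prod_ne_zero_iff.mpr fun r hr =>
      sub_ne_zero.mpr (hz.ne (Finset.ne_of_mem_erase hr).symm)
  constructor
  · intro h k
    refine Finset.sum_eq_zero fun j _ => ?_
    have hj : f.eval (z j) = 0 :=
      dvd_iff_isRoot.mp <|
        (Finset.dvd_prod_of_mem (fun i => X - C (z i)) (Finset.mem_univ j)).trans h
    simp [hj]
  · intro h
    have hw : (fun j => f.eval (z j) / ∏ r ∈ Finset.univ.erase j, (z j - z r)) = 0 :=
      Matrix.eq_zero_of_forall_pow_sum_mul_pow_eq_zero hz fun k => by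
        rw [← h k]
        exact Finset.sum_congr rfl fun j _ => by ring
    refine Fintype.prod_dvd_of_coprime (pairwise_coprime_X_sub_C hz) fun j => ?_
    exact dvd_iff_isRoot.mpr ((div_eq_zero_iff.mp (congrFun hw j)).resolve_right (hne j))
end

section
/- Let k be a field, n ≥ 2, N ≥ 2, and let α_1, …, α_N be nonzero, pairwise linearly independent linear forms in k[x_1,…,x_n]. Let I be the ideal of k[x_1,…,x_n] generated by the N polynomials g_i = α_1⋯\widehat{α_i}⋯α_N (the product of all the α_j with j ≠ i), for i = 1, …, N. Then the Krull dimension of the quotient ring k[x_1,…,x_n]/I equals n − 2. -/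
open MvPolynomial Finset

/-- The linear form in `k[x_1,…,x_n]` corresponding to a covector with coefficients `w`. -/
noncomputable def linForm {R : Type*} [CommSemiring R] {n : ℕ} (w : Fin n → R) :
    MvPolynomial (Fin n) R :=
  ∑ i, MvPolynomial.C (w i) * MvPolynomial.X i

/-- If every prime containing `I` contains an ideal `J` with `dim R ⧸ J ≤ d`, then
`dim R ⧸ I ≤ d`. -/
theorem ringKrullDim_quotient_le_of_forall_prime {R : Type*} [CommRing R] {I : Ideal R}
    {d : WithBot ℕ∞}
    (h : ∀ P : Ideal R, P.IsPrime → I ≤ P → ∃ J ≤ P, ringKrullDim (R ⧸ J) ≤ d) :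
    ringKrullDim (R ⧸ I) ≤ d := by
  rw [ringKrullDim_quotient]
  refine iSup_le fun p => ?_
  obtain ⟨J, hJ, hd⟩ := h p.head.1.asIdeal p.head.1.isPrime p.head.2
  rw [ringKrullDim_quotient] at hd
  let q : LTSeries (PrimeSpectrum.zeroLocus (J : Set R)) :=
    ⟨p.length, fun i => ⟨(p i).1, hJ.trans (p.monotone (Fin.zero_le i))⟩, p.step⟩
  exact (le_iSup (fun q : LTSeries (PrimeSpectrum.zeroLocus (J : Set R)) =>
    ((q.length : ℕ∞) : WithBot ℕ∞)) q).trans hd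

/-- The map sending a covector to its linear form, as a linear map. -/
noncomputable def linFormHom (R : Type*) [CommSemiring R] (n : ℕ) :
    (Fin n → R) →ₗ[R] MvPolynomial (Fin n) R where
  toFun := linForm
  map_add' v w := by simp [linForm, add_mul, Finset.sum_add_distrib]
  map_smul' c w := by simp [linForm, Finset.smul_sum, MvPolynomial.smul_eq_C_mul, mul_assoc]

@[simp]
theorem linFormHom_apply {R : Type*} [CommSemiring R] {n : ℕ} (w : Fin n → R) :
    linFormHom R n w = linForm w := rfl

@[simp]
theorem linForm_single {R : Type*} [CommSemiring R] {n : ℕ} (i : Fin n) :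
    linForm (Pi.single i (1 : R)) = X i := by
  rw [linForm, Finset.sum_eq_single i] <;> simp +contextual

theorem aeval_linForm {R A : Type*} [CommSemiring R] [CommSemiring A] [Algebra R A] {n : ℕ}
    (L : (Fin n → R) →ₗ[R] A) (w : Fin n → R) :
    aeval (fun i => L (Pi.single i 1)) (linForm w) = L w := by
  conv_rhs => rw [pi_eq_sum_univ' w]
  simp only [linForm, map_sum, map_mul, aeval_X, algHom_C, map_smul, ← Algebra.smul_def]

theorem LinearIndependent.sumExtend_inl {K V ι : Type*} [DivisionRing K] [AddCommGroup V]
    [Module K V] {v : ι → V} (hv : LinearIndependent K v) (i : ι) :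
    Module.Basis.sumExtend hv (.inl i) = v i := by
  simp only [Module.Basis.sumExtend, Module.Basis.coe_reindex, Function.comp_apply,
    Module.Basis.coe_extend]
  rfl

/-- Quotienting a polynomial ring by linearly independent linear forms drops the Krull dimension
by the number of forms. -/
theorem ringKrullDim_quotient_span_linForm {k ι : Type*} [Field k] [Finite ι] {n : ℕ}
    {v : ι → Fin n → k} (hv : LinearIndependent k v) :
    ringKrullDim (MvPolynomial (Fin n) k ⧸ Ideal.span (Set.range fun i => linForm (v i)))
      = (n - Nat.card ι : ℕ) := by
  set J := Ideal.span (Set.range fun i => linForm (v i))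
  let b := Module.Basis.sumExtend hv
  have hb (i : ι) : b (.inl i) = v i := hv.sumExtend_inl i
  have hfin : Finite (ι ⊕ Module.Basis.sumExtendIndex hv) := Module.Finite.finite_basis b
  have : Finite (Module.Basis.sumExtendIndex hv) := Finite.sum_right ι
  clear_value b
  generalize Module.Basis.sumExtendIndex hv = κ at *
  have hcard : Nat.card κ = n - Nat.card ι := by
    have := Module.finrank_eq_nat_card_basis b
    rw [Nat.card_sum, Module.finrank_fin_fun] at this
    omega
  have hdim : ringKrullDim (MvPolynomial κ k) = (n - Nat.card ι : ℕ) := by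
    rw [MvPolynomial.ringKrullDim_of_isNoetherianRing, ringKrullDim_eq_zero_of_field, hcard]
    simp
  rw [← hdim]
  apply le_antisymm
  · let ψ : MvPolynomial κ k →ₐ[k] MvPolynomial (Fin n) k ⧸ J :=
      aeval fun m => Ideal.Quotient.mkₐ k J (linForm (b (.inr m)))
    refine ringKrullDim_le_of_surjective ψ.toRingHom (AlgHom.range_eq_top ψ |>.1 ?_)
    let L : (Fin n → k) →ₗ[k] MvPolynomial (Fin n) k ⧸ J :=
      (Ideal.Quotient.mkₐ k J).toLinearMap ∘ₗ linFormHom k n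
    have hL : ⊤ ≤ ψ.range.toSubmodule.comap L := by
      rw [← b.span_eq, Submodule.span_le]
      rintro _ ⟨i | m, rfl⟩
      · have : L (b (.inl i)) = 0 :=
          Ideal.Quotient.eq_zero_iff_mem.2 (hb i ▸ Ideal.subset_span ⟨i, rfl⟩)
        exact ⟨0, by simp [this]⟩
      · exact ⟨X m, by simp [ψ, L]⟩
    have hX : (Ideal.Quotient.mkₐ k J).range ≤ ψ.range := by
      rw [← Algebra.map_top, ← MvPolynomial.adjoin_range_X, AlgHom.map_adjoin,
        Algebra.adjoin_le_iff]
      rintro _ ⟨_, ⟨i, rfl⟩, rfl⟩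
      simpa [L] using hL (Submodule.mem_top (x := Pi.single i (1 : k)))
    rwa [(AlgHom.range_eq_top _).2 (Ideal.Quotient.mkₐ_surjective k J), top_le_iff] at hX
  · let L : (Fin n → k) →ₗ[k] MvPolynomial κ k := b.constr k (Sum.elim 0 X)
    let φ : MvPolynomial (Fin n) k →ₐ[k] MvPolynomial κ k := aeval fun i => L (Pi.single i 1)
    have hφ : ∀ w, φ (linForm w) = L w := aeval_linForm L
    have hJ : ∀ a ∈ J, φ a = 0 := by
      suffices J ≤ RingHom.ker φ from this
      rw [Ideal.span_le]
      rintro _ ⟨i, rfl⟩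
      simp [RingHom.mem_ker, hφ, ← hb, L]
    have hsurj : Function.Surjective φ := by
      rw [← AlgHom.range_eq_top, ← top_le_iff, ← MvPolynomial.adjoin_range_X,
        Algebra.adjoin_le_iff]
      rintro _ ⟨m, rfl⟩
      exact ⟨linForm (b (.inr m)), by simp [hφ, L]⟩
    exact ringKrullDim_le_of_surjective (Ideal.Quotient.lift J φ.toRingHom hJ)
      (Ideal.Quotient.lift_surjective_of_surjective J hJ hsurj)

/-- A prime containing all the products omitting one factor contains two of the factors. -/
theorem Ideal.IsPrime.exists_ne_mem_of_prod_erase_mem {R ι : Type*} [CommRing R] [Fintype ι]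
    [DecidableEq ι] [Nonempty ι] {P : Ideal R} (hP : P.IsPrime) {f : ι → R}
    (h : ∀ i, ∏ j ∈ univ.erase i, f j ∈ P) : ∃ i j, i ≠ j ∧ f i ∈ P ∧ f j ∈ P := by
  obtain ⟨i, -, hi⟩ := hP.prod_mem_iff.1 (h (Classical.arbitrary ι))
  obtain ⟨j, hj, hjP⟩ := hP.prod_mem_iff.1 (h i)
  exact ⟨i, j, (ne_of_mem_erase hj).symm, hi, hjP⟩

/-- **Lemma 2.3.** Let `k` be a field, `n ≥ 2`, `N ≥ 2`, and let `α_1, …, α_N` be nonzero,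
pairwise linearly independent linear forms in `k[x_1,…,x_n]`.  Let `I` be the ideal generated
by the `N` polynomials `g_i = α_1⋯α̂_i⋯α_N`.  Then the Krull dimension of
`k[x_1,…,x_n]/I` equals `n - 2`. -/
theorem krullDim_quotient_productsOmittingOne
    {k : Type*} [Field k] (n N : ℕ) (hn : 2 ≤ n) (hN : 2 ≤ N)
    (γ : Fin N → Fin n → k)
    (hnz : ∀ i, γ i ≠ 0)
    (hind : ∀ i j : Fin N, i ≠ j → LinearIndependent k ![γ i, γ j]) :
    ringKrullDim (MvPolynomial (Fin n) k ⧸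
        Ideal.span (Set.range fun i : Fin N =>
          ∏ j ∈ Finset.univ.erase i, linForm (γ j)))
      = (n - 2 : ℕ) := by
  have hdim (i j : Fin N) (hij : i ≠ j) := ringKrullDim_quotient_span_linForm (hind i j hij)
  simp only [Nat.card_eq_fintype_card, Fintype.card_fin] at hdim
  apply le_antisymm
  · refine ringKrullDim_quotient_le_of_forall_prime fun P hP hI => ?_
    have : Nonempty (Fin N) := ⟨⟨0, by omega⟩⟩
    obtain ⟨i, j, hij, hi, hj⟩ := hP.exists_ne_mem_of_prod_erase_mem
      (f := fun j => linForm (γ j)) fun i => hI (Ideal.subset_span ⟨i, rfl⟩)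
    refine ⟨_, ?_, (hdim i j hij).le⟩
    rw [Ideal.span_le]
    rintro _ ⟨l, rfl⟩
    fin_cases l
    exacts [hi, hj]
  · obtain ⟨i, j, hij⟩ : ∃ i j : Fin N, i ≠ j :=
      ⟨⟨0, by omega⟩, ⟨1, by omega⟩, by simp⟩
    rw [← hdim i j hij]
    refine ringKrullDim_le_of_surjective (Ideal.Quotient.factor ?_)
      (Ideal.Quotient.factor_surjective _)
    rw [Ideal.span_le]
    rintro _ ⟨l, rfl⟩
    by_cases hl : i = l
    · exact Ideal.mem_of_dvd _ (dvd_prod_of_mem _ (mem_erase.2 ⟨hl ▸ hij.symm, mem_univ j⟩))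
        (Ideal.subset_span ⟨1, rfl⟩)
    · exact Ideal.mem_of_dvd _ (dvd_prod_of_mem _ (mem_erase.2 ⟨hl, mem_univ i⟩))
        (Ideal.subset_span ⟨0, rfl⟩)
end

section
/- Let k be a field, let 1 ≤ l ≤ N, and let γ_1, …, γ_N be linear forms in k[x_1,…,x_n] which are l-independent, i.e., any l of them are linearly independent. Let I_l be the ideal generated by the products of all γ_j with j outside {i_1,…,i_{l−1}}, over all sequences 1 ≤ i_1 < ⋯ < i_{l−1} ≤ N. Then the zero locus of I_l in k^n, {v ∈ k^n : g(v) = 0 for all g ∈ I_l}, equals the union over all sequences 1 ≤ i_1 < ⋯ < i_l ≤ N of the sets {v ∈ k^n : γ_{i_1}(v) = ⋯ = γ_{i_l}(v) = 0}. -/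
open MvPolynomial Finset

/-- A family of vectors is `l`-independent if every `l` of them are linearly independent. -/
def LIndep {k : Type*} [Field k] {n N : ℕ} (γ : Fin N → Fin n → k) (l : ℕ) : Prop :=
  ∀ s : Finset (Fin N), s.card = l → LinearIndependent k (fun i : {x // x ∈ s} => γ i.1)

/-- The ideal `I_l` generated by the products of all `γ_j` with `j` outside a set of `l - 1`
indices. -/
noncomputable def omittingIdeal {k : Type*} [Field k] {n N : ℕ} (γ : Fin N → Fin n → k)
    (l : ℕ) : Ideal (MvPolynomial (Fin n) k) :=
  Ideal.span {g | ∃ T : Finset (Fin N), T.card = l - 1 ∧ g = ∏ j ∈ Tᶜ, linForm (γ j)}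

theorem eval_linForm {R : Type*} [CommSemiring R] {n : ℕ} (w v : Fin n → R) :
    MvPolynomial.eval v (linForm w) = ∑ j, w j * v j := by
  simp [linForm]

theorem eval_eq_zero_on_omittingIdeal_iff {k : Type*} [Field k] {n N : ℕ}
    (γ : Fin N → Fin n → k) (l : ℕ) (v : Fin n → k) :
    (∀ g ∈ omittingIdeal γ l, MvPolynomial.eval v g = 0) ↔
      ∀ T : Finset (Fin N), T.card = l - 1 → ∃ j ∉ T, ∑ i, γ j i * v i = 0 := by
  have h : (∀ g ∈ omittingIdeal γ l, MvPolynomial.eval v g = 0) ↔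
      omittingIdeal γ l ≤ RingHom.ker (MvPolynomial.eval v) := Iff.rfl
  rw [h, omittingIdeal, Ideal.span_le]
  constructor
  · intro h T hT
    have hp : MvPolynomial.eval v (∏ j ∈ Tᶜ, linForm (γ j)) = 0 := h ⟨T, hT, rfl⟩
    simpa [map_prod, Finset.prod_eq_zero_iff, eval_linForm] using hp
  · rintro h _ ⟨T, hT, rfl⟩
    simpa [RingHom.mem_ker, map_prod, Finset.prod_eq_zero_iff, eval_linForm] using h T hT

/-- **The zero locus of `I_l` (appendix to §2.10).** Let `k` be a field, `1 ≤ l ≤ N`, and let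
`γ_1, …, γ_N` be `l`-independent linear forms in `k[x_1,…,x_n]`.  Then the zero locus of the
ideal `I_l` in `k^n` is the union, over all `1 ≤ i_1 < ⋯ < i_l ≤ N`, of the subspaces
`{γ_{i_1} = ⋯ = γ_{i_l} = 0}`. -/
theorem zeroLocus_omittingIdeal
    {k : Type*} [Field k] (n N l : ℕ) (hl : 1 ≤ l) (hlN : l ≤ N)
    (γ : Fin N → Fin n → k) (hind : LIndep γ l) :
    {v : Fin n → k | ∀ g ∈ omittingIdeal γ l, MvPolynomial.eval v g = 0}
      = ⋃ (s : Finset (Fin N)) (_ : s.card = l),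
          {v : Fin n → k | ∀ i ∈ s, (∑ j, γ i j * v j) = 0} := by
  classical
  ext v
  simp only [Set.mem_ofPred_eq, Set.mem_iUnion, exists_prop, eval_eq_zero_on_omittingIdeal_iff]
  constructor
  · intro h
    have hcard : l ≤ (Finset.univ.filter fun i => ∑ j, γ i j * v j = 0).card := by
      by_contra! hlt
      obtain ⟨T, hZT, hT⟩ := Finset.exists_superset_card_eq
        (Nat.le_sub_one_of_lt hlt) (by rw [Fintype.card_fin]; omega)
      obtain ⟨j, hjT, hj⟩ := h T hT
      exact hjT (hZT (by simpa using hj))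
    obtain ⟨s, hs, hsl⟩ := Finset.exists_subset_card_eq hcard
    exact ⟨s, hsl, fun i hi => by simpa using hs hi⟩
  · rintro ⟨s, hs, hv⟩ T hT
    obtain ⟨j, hjs, hjT⟩ := Finset.exists_mem_notMem_of_card_lt_card
      (show T.card < s.card by omega)
    exact ⟨j, hjT, hv j hjs⟩
end
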